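/- Let n be a positive integer with n ≡ 1 (mod 6) and n > 1. Then, as rational functions in the two variables a and q over ℚ, ∑_{k=0}^{n−1} (a^5 q^{−1}; q^6)_k (q^{−1}/a^5; q^6)_k (q^{−4}; q^6)_k · q^{6k} / ( (a^4 q^6; q^6)_k (q^6/a^4; q^6)_k (q^6; q^6)_k ) ≡ 0 (mod (1 − a q^n)(a − q^n)). -/

import Mathlib

open Finset

/-- Polynomials in the two variables `a` (index 0) and `q` (index 1) over `ℚ`. -/
abbrev MvP : Type := MvPolynomial (Fin 2) ℚ

/-- The field of rational functions in the two variables `a` and `q` over `ℚ`. -/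
abbrev FF : Type := FractionRing MvP

/-- The variable `a`, viewed in the field of rational functions. -/
noncomputable def av : FF := algebraMap MvP FF (MvPolynomial.X 0)

/-- The variable `q`, viewed in the field of rational functions. -/
noncomputable def qv : FF := algebraMap MvP FF (MvPolynomial.X 1)

/-- The q-shifted factorial `(x; q)_k = ∏_{j=0}^{k-1} (1 - x q^j)`. -/
noncomputable def poch (x q : FF) (k : ℕ) : FF :=
  ∏ j ∈ Finset.range k, (1 - x * q ^ j)

/-- `A ≡ 0 (mod P)`: `A = P · (B / C)` where the denominator `C` is coprime
(has no common non-unit factor) with `P`. -/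
def CongrZero (A : FF) (P : MvP) : Prop :=
  ∃ B C : MvP, C ≠ 0 ∧ IsRelPrime C P ∧
    A = algebraMap MvP FF P * (algebraMap MvP FF B / algebraMap MvP FF C)

/-- The q-shifted factorial over an arbitrary field. -/
def qPoch {K : Type*} [Field K] (x q : K) (k : ℕ) : K :=
  ∏ j ∈ range k, (1 - x * q ^ j)

section QSeries

variable {K : Type*} [Field K]

lemma qPoch_succ (x q : K) (k : ℕ) :
    qPoch x q (k + 1) = qPoch x q k * (1 - x * q ^ k) :=
  prod_range_succ _ _

lemma qPoch_succ' (x q : K) (k : ℕ) :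
    qPoch x q (k + 1) = (1 - x) * qPoch (x * q) q k := by
  rw [qPoch, prod_range_succ', mul_comm, pow_zero, mul_one]
  congr 1
  exact prod_congr rfl fun j _ => by ring

lemma qPoch_add (x q : K) (k l : ℕ) :
    qPoch x q (k + l) = qPoch x q k * qPoch (x * q ^ k) q l := by
  rw [qPoch, prod_range_add]
  congr 1
  exact prod_congr rfl fun j _ => by ring

lemma qPoch_div (x q : K) (k d : ℕ) (h : ∀ k, qPoch x q k ≠ 0) :
    qPoch (x * q ^ d) q k / qPoch x q k = qPoch (x * q ^ k) q d / qPoch x q d := by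
  rw [div_eq_div_iff (h _) (h _), mul_comm, ← qPoch_add, mul_comm, ← qPoch_add, add_comm]

/-- The terminating q-binomial theorem. -/
lemma sum_qPoch_neg_pow (q z : K) (hq : q ≠ 0) (hqq : ∀ k, qPoch q q k ≠ 0) (N M : ℕ)
    (h : N < M) :
    ∑ k ∈ range M, qPoch (q⁻¹ ^ N) q k / qPoch q q k * z ^ k = qPoch (z * q⁻¹ ^ N) q N := by
  induction N generalizing M with
  | zero =>
    obtain ⟨M, rfl⟩ := Nat.exists_eq_succ_of_ne_zero h.ne'
    rw [Nat.succ_eq_add_one, sum_range_succ', sum_eq_zero]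
    · simp [qPoch]
    · intro k _
      simp [qPoch_succ']
  | succ N ih =>
    obtain ⟨M, rfl⟩ := Nat.exists_eq_succ_of_ne_zero (Nat.ne_zero_of_lt h)
    have key : ∀ k, qPoch (q⁻¹ ^ (N + 1)) q (k + 1) / qPoch q q (k + 1) * z ^ (k + 1) =
        qPoch (q⁻¹ ^ N) q (k + 1) / qPoch q q (k + 1) * z ^ (k + 1) -
        z * q⁻¹ ^ (N + 1) * (qPoch (q⁻¹ ^ N) q k / qPoch q q k * z ^ k) := by
      intro k
      have h1 : q⁻¹ ^ (N + 1) * q = q⁻¹ ^ N := by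
        rw [pow_succ, mul_assoc, inv_mul_cancel₀ hq, mul_one]
      have h2 := hqq k
      have h3 := hqq (k + 1)
      rw [qPoch_succ' (q⁻¹ ^ (N + 1)), h1, qPoch_succ (q⁻¹ ^ N)]
      rw [qPoch_succ q] at h3 ⊢
      have h4 := right_ne_zero_of_mul h3
      rw [← h1]
      generalize q⁻¹ ^ (N + 1) = w at *
      field_simp
      ring
    have h0 := ih (M + 1) (by omega)
    rw [sum_range_succ'] at h0
    rw [Nat.succ_eq_add_one, sum_range_succ', sum_congr rfl fun k _ => key k, sum_sub_distrib,
      ← mul_sum, ih M (by omega), qPoch_succ']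
    have h1 : z * q⁻¹ ^ (N + 1) * q = z * q⁻¹ ^ N := by
      rw [pow_succ]; field_simp
    rw [h1]
    have h2 : ∀ x : K, qPoch x q 0 = 1 := fun x => by simp [qPoch]
    simp only [h2] at h0 ⊢
    linear_combination h0

lemma sum_qPoch_neg_eval (q : K) (hq : q ≠ 0) (hqq : ∀ k, qPoch q q k ≠ 0) (N M : ℕ)
    (h : N < M) (f : Polynomial K) (hf : f.natDegree < N) :
    ∑ k ∈ range M, qPoch (q⁻¹ ^ N) q k / qPoch q q k * q ^ k * f.eval (q ^ k) = 0 := by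
  simp only [Polynomial.eval_eq_sum_range' hf, mul_sum]
  rw [sum_comm]
  refine sum_eq_zero fun j hj => ?_
  have hj' : j < N := mem_range.1 hj
  have h0 := sum_qPoch_neg_pow q (q ^ (j + 1)) hq hqq N M h
  have h1 : qPoch (q ^ (j + 1) * q⁻¹ ^ N) q N = 0 := by
    refine prod_eq_zero (i := N - 1 - j) (mem_range.2 (by omega)) ?_
    rw [mul_right_comm, ← pow_add, show j + 1 + (N - 1 - j) = N by omega, ← mul_pow,
      mul_inv_cancel₀ hq, one_pow, sub_self]
  rw [h1] at h0
  calc _ = f.coeff j * ∑ k ∈ range M, qPoch (q⁻¹ ^ N) q k / qPoch q q k * (q ^ (j + 1)) ^ k := by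
        rw [mul_sum]
        exact sum_congr rfl fun k _ => by ring
    _ = 0 := by rw [h0, mul_zero]

lemma exists_poly_qPoch (x q : K) (d : ℕ) :
    ∃ f : Polynomial K, f.natDegree ≤ d ∧ ∀ t, f.eval t = qPoch (x * t) q d := by
  refine ⟨∏ j ∈ range d, (1 - Polynomial.C (x * q ^ j) * Polynomial.X), ?_, fun t => ?_⟩
  · refine (Polynomial.natDegree_prod_le _ _).trans ?_
    refine (sum_le_card_nsmul _ _ 1 fun j _ => ?_).trans (by simp)
    compute_degree
  · rw [Polynomial.eval_prod]
    exact prod_congr rfl fun j _ => by simp; ring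

/-- A terminating `₃φ₂` series vanishes when two of its numerator parameters exceed its denominator
parameters by small powers of the base. -/
lemma sum_qPoch_eq_zero (q y z : K) (hq : q ≠ 0) (hqq : ∀ k, qPoch q q k ≠ 0)
    (hy : ∀ k, qPoch y q k ≠ 0) (hz : ∀ k, qPoch z q k ≠ 0) (N M d e : ℕ) (h : N < M)
    (hde : d + e < N) :
    ∑ k ∈ range M, qPoch (q⁻¹ ^ N) q k * qPoch (y * q ^ d) q k * qPoch (z * q ^ e) q k * q ^ k /
      (qPoch y q k * qPoch z q k * qPoch q q k) = 0 := by
  obtain ⟨f, hf, hf'⟩ := exists_poly_qPoch y q d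
  obtain ⟨g, hg, hg'⟩ := exists_poly_qPoch z q e
  have h0 := sum_qPoch_neg_eval q hq hqq N M h (f * g)
    (lt_of_le_of_lt (Polynomial.natDegree_mul_le.trans (add_le_add hf hg)) hde)
  calc _ = (qPoch y q d * qPoch z q e)⁻¹ *
        ∑ k ∈ range M, qPoch (q⁻¹ ^ N) q k / qPoch q q k * q ^ k * (f * g).eval (q ^ k) := by
        rw [mul_sum]
        refine sum_congr rfl fun k _ => ?_
        rw [Polynomial.eval_mul, hf', hg']
        calc _ = qPoch (q⁻¹ ^ N) q k / qPoch q q k * q ^ k *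
              (qPoch (y * q ^ d) q k / qPoch y q k) * (qPoch (z * q ^ e) q k / qPoch z q k) := by
              ring
          _ = _ := by
              rw [qPoch_div y q k d hy, qPoch_div z q k e hz]
              ring
    _ = 0 := by rw [h0, mul_zero]

lemma qPoch_zpow_ne_zero (q : K) (hq : q ≠ 0) (hq1 : ∀ m : ℤ, m ≠ 0 → q ^ m ≠ 1) (c : ℤ)
    (hc : ∀ j : ℕ, c + 6 * j ≠ 0) (k : ℕ) : qPoch (q ^ c) (q ^ 6) k ≠ 0 := by
  refine prod_ne_zero_iff.2 fun j _ => sub_ne_zero.2 fun h => hq1 _ (hc j) ?_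
  rw [zpow_add₀ hq, h, zpow_mul]
  norm_cast

lemma sum_qPoch_zpow_eq_zero (q : K) (hq : q ≠ 0) (hq1 : ∀ m : ℤ, m ≠ 0 → q ^ m ≠ 1) (n : ℕ)
    (hn : 1 < n) (hmod : n % 6 = 1) :
    ∑ k ∈ range n, qPoch (q ^ (-(5 * n) - 1 : ℤ)) (q ^ 6) k * qPoch (q ^ (5 * n - 1 : ℤ)) (q ^ 6) k *
      qPoch (q ^ (-4 : ℤ)) (q ^ 6) k * q ^ (6 * k) /
      (qPoch (q ^ (4 * n + 6 : ℤ)) (q ^ 6) k * qPoch (q ^ (-(4 * n) + 6 : ℤ)) (q ^ 6) k *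
        qPoch (q ^ 6) (q ^ 6) k) = 0 := by
  obtain ⟨m, rfl⟩ : ∃ m, n = 6 * m + 7 := ⟨n / 6 - 1, by omega⟩
  have h := sum_qPoch_eq_zero (q ^ 6) (q ^ (4 * (6 * m + 7 : ℕ) + 6 : ℤ))
    (q ^ (-(4 * (6 * m + 7 : ℕ)) + 6 : ℤ)) (pow_ne_zero _ hq)
    (by
      have := qPoch_zpow_ne_zero q hq hq1 6 (by omega)
      exact_mod_cast this)
    (qPoch_zpow_ne_zero q hq hq1 _ (by omega)) (qPoch_zpow_ne_zero q hq hq1 _ (by omega))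
    (5 * m + 6) (6 * m + 7) m (4 * m + 3) (by omega) (by omega)
  rw [← h]
  refine sum_congr rfl fun k _ => ?_
  have e : ∀ j : ℕ, (q ^ 6) ^ j = q ^ (6 * j : ℤ) := fun j => by
    rw [zpow_mul]; norm_cast
  rw [inv_pow (q ^ 6), e (5 * m + 6), e m, e (4 * m + 3), ← zpow_neg, ← zpow_add₀ hq,
    ← zpow_add₀ hq, ← pow_mul q 6 k]
  push_cast
  ring_nf

end QSeries

section Specialization

variable {K : Type*} [Field K]

/-- `x` is a fraction `B / C` of polynomials that `φ` sends to `y`, with `φ C ≠ 0`. -/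
def SpecializesTo (φ : MvP →+* K) (x : FF) (y : K) : Prop :=
  ∃ B C : MvP, φ C ≠ 0 ∧ x * algebraMap MvP FF C = algebraMap MvP FF B ∧ y * φ C = φ B

namespace SpecializesTo

variable {φ : MvP →+* K} {x x' : FF} {y y' : K}

lemma of_poly (φ : MvP →+* K) (f : MvP) : SpecializesTo φ (algebraMap MvP FF f) (φ f) :=
  ⟨f, 1, by simp, by simp, by simp⟩

lemma one (φ : MvP →+* K) : SpecializesTo φ 1 1 := by
  simpa using of_poly φ 1

lemma zero (φ : MvP →+* K) : SpecializesTo φ 0 0 := by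
  simpa using of_poly φ 0

lemma add (h : SpecializesTo φ x y) (h' : SpecializesTo φ x' y') :
    SpecializesTo φ (x + x') (y + y') := by
  obtain ⟨B, C, h0, h1, h2⟩ := h
  obtain ⟨B', C', h0', h1', h2'⟩ := h'
  refine ⟨B * C' + B' * C, C * C', by simp [h0, h0'], ?_, ?_⟩
  · simp only [map_mul, map_add, ← h1, ← h1']; ring
  · simp only [map_mul, map_add, ← h2, ← h2']; ring

lemma mul (h : SpecializesTo φ x y) (h' : SpecializesTo φ x' y') :
    SpecializesTo φ (x * x') (y * y') := by
  obtain ⟨B, C, h0, h1, h2⟩ := h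
  obtain ⟨B', C', h0', h1', h2'⟩ := h'
  refine ⟨B * B', C * C', by simp [h0, h0'], ?_, ?_⟩
  · simp only [map_mul, ← h1, ← h1']; ring
  · simp only [map_mul, ← h2, ← h2']; ring

lemma neg (h : SpecializesTo φ x y) : SpecializesTo φ (-x) (-y) := by
  obtain ⟨B, C, h0, h1, h2⟩ := h
  exact ⟨-B, C, h0, by simp [h1], by simp [h2]⟩

lemma sub (h : SpecializesTo φ x y) (h' : SpecializesTo φ x' y') :
    SpecializesTo φ (x - x') (y - y') := by
  simpa only [sub_eq_add_neg] using h.add h'.neg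

lemma inv (h : SpecializesTo φ x y) (hy : y ≠ 0) : SpecializesTo φ x⁻¹ y⁻¹ := by
  obtain ⟨B, C, h0, h1, h2⟩ := h
  have hB : φ B ≠ 0 := h2 ▸ mul_ne_zero hy h0
  have hx : x ≠ 0 := by
    rintro rfl
    rw [zero_mul, eq_comm, map_eq_zero_iff _ (IsFractionRing.injective MvP FF)] at h1
    exact hB (by rw [h1, map_zero])
  exact ⟨C, B, hB, by rw [← h1, inv_mul_cancel_left₀ hx], by rw [← h2, inv_mul_cancel_left₀ hy]⟩

lemma div (h : SpecializesTo φ x y) (h' : SpecializesTo φ x' y') (hy : y' ≠ 0) :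
    SpecializesTo φ (x / x') (y / y') := by
  simpa only [div_eq_mul_inv] using h.mul (h'.inv hy)

lemma pow (h : SpecializesTo φ x y) (k : ℕ) : SpecializesTo φ (x ^ k) (y ^ k) := by
  induction k with
  | zero => simpa using one φ
  | succ k ih => simpa only [pow_succ] using ih.mul h

lemma zpow (h : SpecializesTo φ x y) (hy : y ≠ 0) (k : ℤ) : SpecializesTo φ (x ^ k) (y ^ k) := by
  cases k with
  | ofNat k => simpa using h.pow k
  | negSucc k => simpa only [zpow_negSucc] using (h.pow (k + 1)).inv (pow_ne_zero _ hy)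

lemma sum {f : ℕ → FF} {g : ℕ → K} (h : ∀ k, SpecializesTo φ (f k) (g k)) (n : ℕ) :
    SpecializesTo φ (∑ k ∈ range n, f k) (∑ k ∈ range n, g k) := by
  induction n with
  | zero => simpa using zero φ
  | succ n ih => simpa only [sum_range_succ] using ih.add (h n)

lemma poch (h : SpecializesTo φ x y) (h' : SpecializesTo φ x' y') (k : ℕ) :
    SpecializesTo φ (poch x x' k) (qPoch y y' k) := by
  induction k with
  | zero => simpa [_root_.poch, qPoch] using one φ
  | succ k ih =>
    rw [qPoch_succ, _root_.poch, prod_range_succ]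
    exact ih.mul ((one φ).sub (h.mul (h'.pow k)))

end SpecializesTo

end Specialization

section Divisibility

variable {K : Type*} [Field K]

lemma prime_of_dvd_iff {P : MvP} (hP : P ≠ 0) {φ : MvP →+* K} (h : ∀ f, P ∣ f ↔ φ f = 0) :
    Prime P := by
  refine ⟨hP, fun hu => ?_, fun f g hfg => ?_⟩
  · exact one_ne_zero ((map_one φ).symm.trans ((h 1).1 hu.dvd))
  · rwa [h, map_mul, mul_eq_zero, ← h, ← h] at hfg

lemma congrZero_mul {P R : MvP} {φ ψ : MvP →+* K}
    (hP : P ≠ 0) (hR : R ≠ 0) (hφ : ∀ f, P ∣ f ↔ φ f = 0) (hψ : ∀ f, R ∣ f ↔ ψ f = 0)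
    (hRP : ¬ R ∣ P) {A : FF} (hA : SpecializesTo φ A 0) (hA' : SpecializesTo ψ A 0) :
    CongrZero A (P * R) := by
  have pP := prime_of_dvd_iff hP hφ
  have pR := prime_of_dvd_iff hR hψ
  obtain ⟨N, D, hND, hAD⟩ := IsFractionRing.exists_reduced_fraction (A := MvP) A
  have hD0 : (D : MvP) ≠ 0 := nonZeroDivisors.coe_ne_zero D
  have hD0' : algebraMap MvP FF D ≠ 0 :=
    (map_ne_zero_iff _ (IsFractionRing.injective MvP FF)).2 hD0
  have hA1 : A = algebraMap MvP FF N / algebraMap MvP FF D := by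
    rw [← hAD, IsFractionRing.mk'_eq_div]
  have aux : ∀ (χ : MvP →+* K) (S : MvP), Prime S →
      (∀ f, S ∣ f ↔ χ f = 0) → SpecializesTo χ A 0 → S ∣ N ∧ ¬ S ∣ D := by
    intro χ S pS hS hA
    obtain ⟨B, C, h0, h1, h2⟩ := hA
    have hNC : N * C = B * D := by
      apply IsFractionRing.injective MvP FF
      rw [map_mul, map_mul, ← h1, hA1]
      field_simp
    have hSB : S ∣ B := (hS B).2 (by rw [← h2, zero_mul])
    have hSC : ¬ S ∣ C := fun h => h0 ((hS C).1 h)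
    have hDC : (D : MvP) ∣ C := hND.symm.dvd_of_dvd_mul_left (Dvd.intro_left _ hNC.symm)
    refine ⟨(pS.dvd_or_dvd (hNC ▸ hSB.mul_right _)).resolve_right hSC, fun h => hSC (h.trans hDC)⟩
  obtain ⟨⟨E, rfl⟩, hPD⟩ := aux φ P pP hφ hA
  obtain ⟨hRN, hRD⟩ := aux ψ R pR hψ hA'
  obtain ⟨G, rfl⟩ := (pR.dvd_or_dvd hRN).resolve_left hRP
  refine ⟨G, D, hD0, ?_, ?_⟩
  · exact IsRelPrime.mul_right ((pP.irreducible.isRelPrime_iff_not_dvd.2 hPD).symm)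
      ((pR.irreducible.isRelPrime_iff_not_dvd.2 hRD).symm)
  · rw [hA1]
    simp only [map_mul]
    ring

end Divisibility

section Kernel

open MvPolynomial

lemma exists_dvd_sub_aeval {P : MvP} {n : ℕ} (hP : P ∣ X 0 - X 1 ^ n) (f : MvP) :
    ∃ g : Polynomial ℚ, P ∣ f - Polynomial.aeval (X 1) g := by
  induction f using MvPolynomial.induction_on with
  | C c => exact ⟨Polynomial.C c, by simp [MvPolynomial.algebraMap_eq]⟩
  | add f g hf hg =>
    obtain ⟨f', hf⟩ := hf
    obtain ⟨g', hg⟩ := hg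
    refine ⟨f' + g', ?_⟩
    rw [map_add, add_sub_add_comm]
    exact dvd_add hf hg
  | mul_X f i hf =>
    obtain ⟨g, hf⟩ := hf
    fin_cases i
    · refine ⟨g * Polynomial.X ^ n, ?_⟩
      have := dvd_add (hf.mul_right (X 0)) (hP.mul_left (Polynomial.aeval (X 1) g))
      convert this using 1
      simp only [map_mul, map_pow, Polynomial.aeval_X, Fin.mk_zero]
      ring
    · refine ⟨g * Polynomial.X, ?_⟩
      convert hf.mul_right (X 1) using 1
      simp only [map_mul, Polynomial.aeval_X, Fin.mk_one]
      ring

lemma exists_dvd_pow_mul_sub_aeval {P : MvP} {n : ℕ} (hP : P ∣ 1 - X 0 * X 1 ^ n) (f : MvP) :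
    ∃ (N : ℕ) (g : Polynomial ℚ), P ∣ X 1 ^ N * f - Polynomial.aeval (X 1) g := by
  induction f using MvPolynomial.induction_on with
  | C c => exact ⟨0, Polynomial.C c, by simp [MvPolynomial.algebraMap_eq]⟩
  | add f g hf hg =>
    obtain ⟨N, f', hf⟩ := hf
    obtain ⟨M, g', hg⟩ := hg
    refine ⟨N + M, Polynomial.X ^ M * f' + Polynomial.X ^ N * g', ?_⟩
    convert dvd_add (hf.mul_left (X 1 ^ M)) (hg.mul_left (X 1 ^ N)) using 1
    simp only [map_add, map_mul, map_pow, Polynomial.aeval_X]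
    ring
  | mul_X f i hf =>
    obtain ⟨N, g, hf⟩ := hf
    fin_cases i
    · refine ⟨N + n, g, ?_⟩
      have := dvd_sub hf (hP.mul_left (X 1 ^ N * f))
      convert this using 1
      simp only [Fin.mk_zero]
      ring
    · refine ⟨N, g * Polynomial.X, ?_⟩
      convert hf.mul_right (X 1) using 1
      simp only [map_mul, Polynomial.aeval_X, Fin.mk_one]
      ring

variable {K : Type*} [Field K] [Algebra ℚ K]

lemma eq_zero_of_dvd_sub_aeval {P f : MvP} {φ : MvP →ₐ[ℚ] K} (hφ : Transcendental ℚ (φ (X 1)))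
    (hP : φ P = 0) (hf : φ f = 0) {g : Polynomial ℚ}
    (h : P ∣ f - Polynomial.aeval (X 1) g) : g = 0 := by
  obtain ⟨c, hc⟩ := h
  have := congrArg φ hc
  rw [map_sub, map_mul, hP, hf, zero_mul, zero_sub, neg_eq_zero, ← Polynomial.aeval_algHom_apply] at this
  exact transcendental_iff.1 hφ g this

lemma X_sub_X_pow_dvd_iff {φ : MvP →ₐ[ℚ] K} (hφ : Transcendental ℚ (φ (X 1))) {n : ℕ}
    (h : φ (X 0) = φ (X 1) ^ n) (f : MvP) : X 0 - X 1 ^ n ∣ f ↔ φ f = 0 := by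
  have hP : φ (X 0 - X 1 ^ n) = 0 := by simp [h]
  refine ⟨fun ⟨c, hc⟩ => by rw [hc, map_mul, hP, zero_mul], fun hf => ?_⟩
  obtain ⟨g, hg⟩ := exists_dvd_sub_aeval dvd_rfl f
  rw [eq_zero_of_dvd_sub_aeval hφ hP hf hg] at hg
  simpa using hg

lemma one_sub_X_mul_X_pow_dvd_iff {φ : MvP →ₐ[ℚ] K} (hφ : Transcendental ℚ (φ (X 1))) {n : ℕ}
    (hn : n ≠ 0) (h : φ (X 0) * φ (X 1) ^ n = 1) (f : MvP) :
    1 - X 0 * X 1 ^ n ∣ f ↔ φ f = 0 := by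
  have hP : φ (1 - X 0 * X 1 ^ n) = 0 := by simp [h]
  refine ⟨fun ⟨c, hc⟩ => by rw [hc, map_mul, hP, zero_mul], fun hf => ?_⟩
  obtain ⟨N, g, hg⟩ := exists_dvd_pow_mul_sub_aeval dvd_rfl f
  rw [eq_zero_of_dvd_sub_aeval hφ hP (by rw [map_mul, hf, mul_zero]) hg, map_zero, sub_zero] at hg
  have hc : IsCoprime (1 - X 0 * X 1 ^ n : MvP) (X 1) := by
    obtain ⟨m, rfl⟩ := Nat.exists_eq_succ_of_ne_zero hn
    exact ⟨1, X 0 * X 1 ^ m, by rw [pow_succ]; ring⟩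
  exact (hc.pow_right (n := N)).dvd_of_dvd_mul_left hg

end Kernel

lemma zpow_ne_one_of_transcendental {K : Type*} [Field K] [Algebra ℚ K] {q : K}
    (hq : Transcendental ℚ q) (m : ℤ) (hm : m ≠ 0) : q ^ m ≠ 1 := by
  have key : ∀ k : ℕ, k ≠ 0 → q ^ k ≠ 1 := fun k hk h => by
    refine Polynomial.X_pow_sub_C_ne_zero (R := ℚ) (Nat.pos_of_ne_zero hk) 1 ?_
    exact transcendental_iff.1 hq _ (by simp [h])
  intro h
  refine key m.natAbs (by omega) ?_
  rcases Int.natAbs_eq m with h' | h' <;> rw [h'] at h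
  · exact_mod_cast h
  · rw [zpow_neg, inv_eq_one] at h
    exact_mod_cast h

open MvPolynomial in
lemma specializesTo_sum {K : Type*} [Field K] (φ : MvP →+* K) (hq : φ (X 1) ≠ 0)
    (hq1 : ∀ m : ℤ, m ≠ 0 → φ (X 1) ^ m ≠ 1) (n : ℕ) (hn : 1 < n) (hmod : n % 6 = 1) (s : ℤ)
    (hs : s = 1 ∨ s = -1) (ha : φ (X 0) = φ (X 1) ^ (s * n)) :
    SpecializesTo φ
      (∑ k ∈ range n,
        poch (av ^ 5 * qv ^ (-1 : ℤ)) (qv ^ 6) k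
            * poch (qv ^ (-1 : ℤ) * av ^ (-5 : ℤ)) (qv ^ 6) k
            * poch (qv ^ (-4 : ℤ)) (qv ^ 6) k * qv ^ (6 * k)
          / (poch (av ^ 4 * qv ^ 6) (qv ^ 6) k * poch (qv ^ 6 * av ^ (-4 : ℤ)) (qv ^ 6) k
              * poch (qv ^ 6) (qv ^ 6) k)) 0 := by
  have sq : SpecializesTo φ qv (φ (X 1)) := .of_poly φ _
  have sa : SpecializesTo φ av (φ (X 1) ^ (s * n)) := ha ▸ .of_poly φ _
  generalize φ (X 1) = q at *
  have ha0 : q ^ (s * n) ≠ 0 := zpow_ne_zero _ hq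
  have e1 : (q ^ (s * n)) ^ 5 * q ^ (-1 : ℤ) = q ^ (5 * (s * n) - 1) := by
    rw [sub_eq_add_neg, zpow_add₀ hq, mul_comm 5, zpow_mul q _ 5]; norm_cast
  have e2 : q ^ (-1 : ℤ) * (q ^ (s * n)) ^ (-5 : ℤ) = q ^ (-(5 * (s * n)) - 1) := by
    rw [← zpow_mul, ← zpow_add₀ hq]; ring_nf
  have e3 : (q ^ (s * n)) ^ 4 * q ^ 6 = q ^ (4 * (s * n) + 6) := by
    rw [zpow_add₀ hq, mul_comm 4, zpow_mul q _ 4]; norm_cast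
  have e4 : q ^ 6 * (q ^ (s * n)) ^ (-4 : ℤ) = q ^ (-(4 * (s * n)) + 6) := by
    rw [← zpow_mul, zpow_add₀ hq, mul_comm, mul_comm _ (-4 : ℤ), neg_mul]
    norm_cast
  have s1 := (sa.pow 5).mul (sq.zpow hq (-1))
  have s2 := (sq.zpow hq (-1)).mul (sa.zpow ha0 (-5))
  have s3 := (sa.pow 4).mul (sq.pow 6)
  have s4 := (sq.pow 6).mul (sa.zpow ha0 (-4))
  rw [e1] at s1
  rw [e2] at s2
  rw [e3] at s3
  rw [e4] at s4
  have hs' : s * n = n ∨ s * n = -n := by rcases hs with rfl | rfl <;> simp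
  convert SpecializesTo.sum (fun k => ((((s1.poch (sq.pow 6) k).mul (s2.poch (sq.pow 6) k)).mul
    ((sq.zpow hq (-4)).poch (sq.pow 6) k)).mul (sq.pow (6 * k))).div
    (((s3.poch (sq.pow 6) k).mul (s4.poch (sq.pow 6) k)).mul
      ((sq.pow 6).poch (sq.pow 6) k)) (mul_ne_zero (mul_ne_zero ?_ ?_) ?_)) n using 1
  · rw [← sum_qPoch_zpow_eq_zero q hq hq1 n hn hmod]
    refine sum_congr rfl fun k _ => ?_
    rcases hs' with h | h <;> rw [h]
    · ring
    · simp only [mul_neg, neg_neg]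
      ring
  · exact qPoch_zpow_ne_zero q hq hq1 _ (by omega) k
  · exact qPoch_zpow_ne_zero q hq hq1 _ (by omega) k
  · have := qPoch_zpow_ne_zero q hq hq1 6 (by omega) k
    exact_mod_cast this

theorem stmt11 (n : ℕ) (hn : 1 < n) (hmod : n % 6 = 1) :
    CongrZero
      (∑ k ∈ Finset.range n,
        poch (av ^ 5 * qv ^ (-1 : ℤ)) (qv ^ 6) k
            * poch (qv ^ (-1 : ℤ) * av ^ (-5 : ℤ)) (qv ^ 6) k
            * poch (qv ^ (-4 : ℤ)) (qv ^ 6) k * qv ^ (6 * k)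
          / (poch (av ^ 4 * qv ^ 6) (qv ^ 6) k * poch (qv ^ 6 * av ^ (-4 : ℤ)) (qv ^ 6) k
              * poch (qv ^ 6) (qv ^ 6) k))
      ((1 - MvPolynomial.X 0 * MvPolynomial.X 1 ^ n)
        * (MvPolynomial.X 0 - MvPolynomial.X 1 ^ n)) := by
  have ht : Transcendental ℚ (RatFunc.X : RatFunc ℚ) := by
    convert RatFunc.transcendental_X (K := ℚ)
    exact Subsingleton.elim _ _
  have hq : (RatFunc.X : RatFunc ℚ) ≠ 0 := RatFunc.X_ne_zero
  have hq1 := zpow_ne_one_of_transcendental ht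
  set φ : MvP →ₐ[ℚ] RatFunc ℚ :=
    MvPolynomial.aeval ![RatFunc.X ^ (-1 * n : ℤ), RatFunc.X] with hφ
  set ψ : MvP →ₐ[ℚ] RatFunc ℚ :=
    MvPolynomial.aeval ![RatFunc.X ^ (1 * n : ℤ), RatFunc.X] with hψ
  have φ0 : φ (MvPolynomial.X 0) = RatFunc.X ^ (-1 * n : ℤ) := by simp [hφ]
  have φ1 : φ (MvPolynomial.X 1) = RatFunc.X := by simp [hφ]
  have ψ0 : ψ (MvPolynomial.X 0) = RatFunc.X ^ (1 * n : ℤ) := by simp [hψ]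
  have ψ1 : ψ (MvPolynomial.X 1) = RatFunc.X := by simp [hψ]
  have hφ' := one_sub_X_mul_X_pow_dvd_iff (φ := φ) (by rwa [φ1]) (n := n) (by omega)
    (by rw [φ0, φ1, ← zpow_natCast, ← zpow_add₀ hq]; simp)
  have hψ' := X_sub_X_pow_dvd_iff (φ := ψ) (by rwa [ψ1]) (n := n)
    (by rw [ψ0, ψ1, one_mul, zpow_natCast])
  have hne : ψ (1 - MvPolynomial.X 0 * MvPolynomial.X 1 ^ n) ≠ 0 := by
    rw [map_sub, map_mul, map_pow, map_one, ψ0, ψ1, ← zpow_natCast, ← zpow_add₀ hq]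
    exact sub_ne_zero.2 (hq1 _ (by omega)).symm
  have hne' : φ (MvPolynomial.X 0 - MvPolynomial.X 1 ^ n) ≠ 0 := by
    rw [map_sub, map_pow, φ0, φ1, ← zpow_natCast]
    intro h
    refine hq1 (2 * n : ℤ) (by omega) ?_
    rw [two_mul, zpow_add₀ hq]
    nth_rewrite 1 [← sub_eq_zero.1 h]
    rw [← zpow_add₀ hq]
    simp
  refine congrZero_mul (φ := (φ : MvP →+* RatFunc ℚ)) (ψ := (ψ : MvP →+* RatFunc ℚ))
    (fun h => hne (by rw [h, map_zero])) (fun h => hne' (by rw [h, map_zero])) hφ' hψ'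
    (fun h => hne ((hψ' _).1 h)) ?_ ?_
  · exact specializesTo_sum _ (by simpa [φ1] using hq) (by simpa [φ1] using hq1) n hn hmod (-1)
      (.inr rfl) (by simpa [φ1] using φ0)
  · exact specializesTo_sum _ (by simpa [ψ1] using hq) (by simpa [ψ1] using hq1) n hn hmod 1
      (.inl rfl) (by simpa [ψ1] using ψ0)
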